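/- Let θ > 0 and L̃ ∈ ℕ with L̃ > 1/(2θ). Then there exist constants c, γ > 0 depending only on L̃ and θ such that for every ε ∈ (0,1) there exists a deep ReLU net ×̃₂ : ℝ² → ℝ with 2L̃ + 8 hidden layers and at most c ε^{−θ} nonzero parameters, each bounded in absolute value by ε^{−γ}, such that |uu′ − ×̃₂(u, u′)| ≤ ε for all u, u′ ∈ [−2, 2]. -/

import Mathlib

open scoped Classical BigOperators

noncomputable section

/-- The ReLU activation. -/
def relu (t : ℝ) : ℝ := max t 0

/-- The cube `[-1,1]^d`. -/
def cube (d : ℕ) : Set (Fin d → ℝ) := {x | ∀ i, |x i| ≤ 1}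

/-- The Euclidean norm on `Fin d → ℝ`. -/
def enorm2 {d : ℕ} (x : Fin d → ℝ) : ℝ := Real.sqrt (∑ i, (x i) ^ 2)

/-- A deep ReLU net with `L` hidden layers on input dimension `d`:
`h₀(x) = x`, `h_{k+1}(x) = σ(W_k h_k(x) + b_k)` componentwise with `σ = relu`,
and output `a ⬝ h_L(x)`. -/
structure ReLUNet (d : ℕ) where
  L : ℕ
  width : ℕ → ℕ
  width_zero : width 0 = d
  W : (k : ℕ) → Matrix (Fin (width (k + 1))) (Fin (width k)) ℝ
  b : (k : ℕ) → Fin (width (k + 1)) → ℝ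
  a : Fin (width L) → ℝ

namespace ReLUNet

variable {d : ℕ}

/-- The vector of hidden-layer values. -/
def hidden (net : ReLUNet d) (x : Fin d → ℝ) : (k : ℕ) → Fin (net.width k) → ℝ
  | 0, i => x (Fin.cast net.width_zero i)
  | k + 1, i => relu ((∑ j, net.W k i j * hidden net x k j) + net.b k i)

/-- The output of the network. -/
def eval (net : ReLUNet d) (x : Fin d → ℝ) : ℝ :=
  ∑ i, net.a i * net.hidden x net.L i

/-- The number of free (nonzero) parameters of the network: the nonzero entries of
the matrices `W_k` and of the vectors `b_k` (for `k < L`) and of `a`. -/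
def numParams (net : ReLUNet d) : ℕ :=
  (∑ k ∈ Finset.range net.L,
      ((Finset.univ.filter fun p : Fin (net.width (k + 1)) × Fin (net.width k) =>
          net.W k p.1 p.2 ≠ 0).card
        + (Finset.univ.filter fun i : Fin (net.width (k + 1)) => net.b k i ≠ 0).card))
    + (Finset.univ.filter fun i : Fin (net.width net.L) => net.a i ≠ 0).card

/-- All weights, thresholds and outer coefficients are bounded by `R` in absolute value. -/
def paramBound (net : ReLUNet d) (R : ℝ) : Prop :=
  (∀ k < net.L, ∀ i j, |net.W k i j| ≤ R) ∧
    (∀ k < net.L, ∀ i, |net.b k i| ≤ R) ∧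
    ∀ i, |net.a i| ≤ R

end ReLUNet

/-- A layer with weights and thresholds indexed by natural numbers; only the indices below the
widths matter. -/
structure ReLULayer where
  width : ℕ
  W : ℕ → ℕ → ℝ
  b : ℕ → ℝ

namespace ReLULayer

/-- The width of the `k`-th layer of a net with input dimension `d`. -/
def netWidth (d : ℕ) (l : ℕ → ReLULayer) : ℕ → ℕ
  | 0 => d
  | k + 1 => (l k).width

/-- The net with `n` hidden layers taken from the sequence `l`. -/
def toNet (d n : ℕ) (l : ℕ → ReLULayer) (a : ℕ → ℝ) : ReLUNet d where
  L := n
  width := netWidth d l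
  width_zero := rfl
  W k i j := (l k).W i j
  b k i := (l k).b i
  a i := a i

variable {d n : ℕ} {l : ℕ → ReLULayer} {a : ℕ → ℝ}

lemma hidden_succ {x : Fin d → ℝ} {k : ℕ} {F : ℕ → ℝ}
    (hF : ∀ i, (toNet d n l a).hidden x k i = F i) (i : Fin (netWidth d l (k + 1))) :
    (toNet d n l a).hidden x (k + 1) i =
      relu ((∑ j ∈ Finset.range (netWidth d l k), (l k).W i j * F j) + (l k).b i) := by
  rw [← Fin.sum_univ_eq_sum_range (fun j => (l k).W i j * F j)]
  simp only [ReLUNet.hidden, hF]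
  rfl

lemma eval_eq {x : Fin d → ℝ} {F : ℕ → ℝ}
    (hF : ∀ i, (toNet d n l a).hidden x n i = F i) :
    (toNet d n l a).eval x = ∑ j ∈ Finset.range (netWidth d l n), a j * F j := by
  rw [← Fin.sum_univ_eq_sum_range (fun j => a j * F j)]
  exact Finset.sum_congr rfl fun i _ => congrArg (a i * ·) (hF i)

lemma numParams_le {C : ℕ}
    (hC : ∀ k < n, netWidth d l (k + 1) * netWidth d l k + netWidth d l (k + 1) ≤ C) :
    (toNet d n l a).numParams ≤ n * C + netWidth d l n := by
  unfold ReLUNet.numParams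
  refine add_le_add ?_ ((Finset.card_le_univ _).trans (Fintype.card_fin _).le)
  refine (Finset.sum_le_card_nsmul _ _ C fun k hk => ?_).trans (by simp [toNet])
  refine le_trans (add_le_add (Finset.card_le_univ _) (Finset.card_le_univ _)) ?_
  rw [Fintype.card_prod, Fintype.card_fin, Fintype.card_fin]
  exact hC k (Finset.mem_range.mp hk)

lemma paramBound_of_forall {R : ℝ}
    (hW : ∀ k < n, ∀ i < netWidth d l (k + 1), ∀ j < netWidth d l k, |(l k).W i j| ≤ R)
    (hb : ∀ k < n, ∀ i < netWidth d l (k + 1), |(l k).b i| ≤ R) (ha : ∀ i, |a i| ≤ R) :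
    (toNet d n l a).paramBound R :=
  ⟨fun k hk i j => hW k hk i i.2 j j.2, fun k hk i => hb k hk i i.2, fun i => ha i⟩

end ReLULayer

lemma relu_of_nonneg {t : ℝ} (h : 0 ≤ t) : relu t = t := max_eq_left h

lemma relu_of_nonpos {t : ℝ} (h : t ≤ 0) : relu t = 0 := max_eq_right h

lemma relu_add_relu_neg (t : ℝ) : relu t + relu (-t) = |t| := by
  rcases le_total 0 t with h | h
  · rw [relu_of_nonneg h, relu_of_nonpos (by linarith), abs_of_nonneg h, add_zero]
  · rw [relu_of_nonpos h, relu_of_nonneg (by linarith), abs_of_nonpos h, zero_add]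

lemma relu_div {t c : ℝ} (hc : 0 ≤ c) : relu (t / c) = relu t / c := by
  rw [relu, relu, ← max_div_div_right hc, zero_div]

/-- The change of slope, up to sign, of the unit triangle wave at the knot `j`. -/
def kink (j : ℕ) : ℝ := if j = 0 then 1 else 2

lemma sum_kink_of_le (n : ℕ) (y : ℝ) (h0 : 0 ≤ y) (hy : (n : ℝ) ≤ y) :
    ∑ j ∈ Finset.range (n + 1), kink j * (-1) ^ j * relu (y - j) =
        1 / 2 + (-1) ^ n * (y - n - 1 / 2) ∧
      ∑ j ∈ Finset.range (n + 1), kink j * relu (y - j) = (2 * n + 1) * y - n * (n + 1) := by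
  induction n with
  | zero => simp [kink, relu_of_nonneg h0]
  | succ n ih =>
    push_cast at hy
    obtain ⟨h1, h2⟩ := ih (by linarith)
    rw [Finset.sum_range_succ, h1, Finset.sum_range_succ, h2]
    have hr : relu (y - ((n + 1 : ℕ) : ℝ)) = y - (n + 1) := by
      push_cast; exact relu_of_nonneg (by linarith)
    rw [hr]
    simp only [kink, Nat.succ_ne_zero, if_false, pow_succ]
    push_cast
    constructor <;> ring

lemma sum_kink (n : ℕ) (y : ℝ) (h0 : 0 ≤ y) (hy : y ≤ n) :
    let A := ∑ j ∈ Finset.range n, kink j * (-1) ^ j * relu (y - j)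
    0 ≤ A ∧ A ≤ 1 ∧ ∑ j ∈ Finset.range n, kink j * relu (y - j) - y ^ 2 = A - A ^ 2 := by
  induction n with
  | zero =>
    have : y = 0 := le_antisymm (by simpa using hy) h0
    simp [this]
  | succ n ih =>
    push_cast at hy
    rcases le_total y n with h | h
    · have hr : relu (y - n) = 0 := relu_of_nonpos (by linarith)
      simpa [Finset.sum_range_succ, hr] using ih h
    · obtain ⟨h1, h2⟩ := sum_kink_of_le n y h0 h
      simp only [h1, h2]
      rcases neg_one_pow_eq_or ℝ n with e | e <;> rw [e] <;>
        refine ⟨by linarith, by linarith, by ring⟩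

/-- A triangle wave on `[0,1]` with `N` linear pieces and height `σ`. -/
def tooth (σ : ℝ) (N : ℕ) (x : ℝ) : ℝ :=
  ∑ j ∈ Finset.range N, σ * (kink j * (-1) ^ j * N) * relu (x - j / N)

/-- The coefficients of the piecewise linear interpolant of `x ↦ x - x ^ 2`. -/
def bumpCoeff (N j : ℕ) : ℝ := (if j = 0 then 1 else 0) - kink j / N

/-- The piecewise linear interpolant of `x ↦ x - x ^ 2` at the multiples of `1 / N`. -/
def bump (N : ℕ) (x : ℝ) : ℝ :=
  ∑ j ∈ Finset.range N, bumpCoeff N j * relu (x - j / N)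

/-- The approximation of the square by `k` refinements of the identity. -/
def sqApprox (σ : ℝ) (N : ℕ) : ℕ → ℝ → ℝ
  | 0, x => x
  | k + 1, x => sqApprox σ N k x - ((N : ℝ) ^ (2 * k))⁻¹ * bump N ((tooth σ N)^[k] x)

lemma relu_sub_div {N : ℕ} (hN : 0 < N) (x : ℝ) (j : ℕ) :
    relu (x - j / N) = relu (N * x - j) / N := by
  have : (0 : ℝ) < N := by exact_mod_cast hN
  rw [← relu_div this.le]
  congr 1
  field_simp

lemma tooth_bump {N : ℕ} (hN : 0 < N) {x : ℝ} (hx : x ∈ Set.Icc (0 : ℝ) 1) :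
    tooth 1 N x ∈ Set.Icc (0 : ℝ) 1 ∧
      x - x ^ 2 = bump N x + ((N : ℝ) ^ 2)⁻¹ * (tooth 1 N x - tooth 1 N x ^ 2) := by
  have hN' : (0 : ℝ) < N := by exact_mod_cast hN
  obtain ⟨h1, h2, h3⟩ := sum_kink N (N * x) (mul_nonneg hN'.le hx.1)
    (mul_le_of_le_one_right hN'.le hx.2)
  have ht : tooth 1 N x =
      ∑ j ∈ Finset.range N, kink j * (-1) ^ j * relu (N * x - j) := by
    refine Finset.sum_congr rfl fun j _ => ?_
    rw [relu_sub_div hN]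
    field_simp
  have hb : bump N x =
      x - ((N : ℝ) ^ 2)⁻¹ * ∑ j ∈ Finset.range N, kink j * relu (N * x - j) := by
    have h0 : ∑ j ∈ Finset.range N, (if j = 0 then (1 : ℝ) else 0) * relu (x - j / N) = x := by
      simp [ite_mul, hN, relu_of_nonneg hx.1]
    nth_rw 2 [← h0]
    rw [Finset.mul_sum, ← Finset.sum_sub_distrib, bump]
    refine Finset.sum_congr rfl fun j _ => ?_
    rw [bumpCoeff, relu_sub_div hN]
    field_simp
  rw [ht, hb, ← h3]
  refine ⟨⟨h1, h2⟩, ?_⟩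
  field_simp
  ring

lemma sqApprox_one {N : ℕ} (hN : 0 < N) {x : ℝ} (hx : x ∈ Set.Icc (0 : ℝ) 1) (k : ℕ) :
    (tooth 1 N)^[k] x ∈ Set.Icc (0 : ℝ) 1 ∧
      sqApprox 1 N k x - x ^ 2 =
        ((N : ℝ) ^ (2 * k))⁻¹ * ((tooth 1 N)^[k] x - (tooth 1 N)^[k] x ^ 2) := by
  induction k with
  | zero => simpa [sqApprox] using hx
  | succ k ih =>
    obtain ⟨h1, h2⟩ := ih
    obtain ⟨h3, h4⟩ := tooth_bump hN h1
    rw [Function.iterate_succ_apply']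
    refine ⟨h3, ?_⟩
    rw [sqApprox, sub_right_comm, h2, ← mul_sub, h4, add_sub_cancel_left, ← mul_assoc, ← mul_inv,
      ← pow_add, mul_add, mul_one]

lemma sqApprox_zero {N : ℕ} (hN : 0 < N) {x : ℝ} (hx : x ∈ Set.Icc (0 : ℝ) 1) (k : ℕ) :
    (tooth 0 N)^[k + 1] x = 0 ∧
      sqApprox 0 N (k + 1) x - x ^ 2 =
        ((N : ℝ) ^ 2)⁻¹ * (tooth 1 N x - tooth 1 N x ^ 2) := by
  have ht : ∀ y, tooth 0 N y = 0 := fun y => by simp [tooth]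
  induction k with
  | zero =>
    refine ⟨by simp [ht], ?_⟩
    have := (tooth_bump hN hx).2
    simp only [sqApprox, mul_zero, pow_zero, inv_one, one_mul, Function.iterate_zero, id]
    linarith
  | succ k ih =>
    have hb : bump N 0 = 0 := by
      refine Finset.sum_eq_zero fun j _ => ?_
      rw [relu_of_nonpos, mul_zero]
      rw [zero_sub, neg_nonpos]
      positivity
    rw [Function.iterate_succ_apply']
    refine ⟨ht _, ?_⟩
    rw [sqApprox, ih.1, hb, mul_zero, sub_zero, ih.2]

lemma sub_sq_mem {t : ℝ} (ht : t ∈ Set.Icc (0 : ℝ) 1) : t - t ^ 2 ∈ Set.Icc (0 : ℝ) (1 / 4) :=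
  ⟨by nlinarith [ht.1, ht.2], by nlinarith [sq_nonneg (t - 1 / 2)]⟩

/-- The first layer computes the positive and negative parts of `(u ± u') / 4`. -/
def signLayer : ReLULayer where
  width := 4
  W i j := (if i < 2 then 1 / 4 else -1 / 4) * (if j = 1 ∧ i % 2 = 1 then -1 else 1)
  b _ := 0

/-- The second layer computes two copies of the absolute values. -/
def foldLayer : ReLULayer where
  width := 4
  W i j := if i % 2 = j % 2 then 1 else 0
  b _ := 0

/-- The layer that computes the hinge functions at the knots. -/
def hingeLayer (N : ℕ) : ReLULayer where
  width := 2 * N + 2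
  W i j := if j = (if i < 2 then i else 2 + i % 2) then 1 else 0
  b i := if i < 2 then 0 else -(((i / 2 - 1 : ℕ) : ℝ) / N)

/-- The layer that refines the approximation of the square and applies the triangle wave. -/
def refineLayer (σ : ℝ) (N k : ℕ) : ReLULayer where
  width := 4
  W i j :=
    if j < 2 then (if i = j then 1 else 0)
    else if j % 2 = i % 2 then
      (if i < 2 then -(((N : ℝ) ^ (2 * k))⁻¹ * bumpCoeff N (j / 2 - 1))
        else σ * (kink (j / 2 - 1) * (-1) ^ (j / 2 - 1) * N))
    else 0
  b _ := 0

/-- The layer that makes four copies of each of the two approximate squares. -/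
def copyLayer : ReLULayer where
  width := 8
  W i j := if j = i % 2 then 1 else 0
  b _ := 0

/-- The layers of the product gate with `m` refinements. -/
def gateLayer (σ : ℝ) (m N k : ℕ) : ReLULayer :=
  if k = 0 then signLayer
  else if k = 1 then foldLayer
  else if k < 2 * m + 2 then
    if k % 2 = 0 then hingeLayer N else refineLayer σ N ((k - 2) / 2)
  else copyLayer

/-- The product gate with `m` refinements. -/
def productGate (σ : ℝ) (m N : ℕ) : ReLUNet 2 :=
  ReLULayer.toNet 2 (2 * m + 8) (gateLayer σ m N) fun i => (-1) ^ i

open ReLULayer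

section Layers

variable {σ : ℝ} {m N : ℕ}

lemma gateLayer_hinge {s : ℕ} (hs : s < m) : gateLayer σ m N (2 * s + 2) = hingeLayer N := by
  unfold gateLayer
  rw [if_neg (by omega), if_neg (by omega), if_pos (by omega), if_pos (by omega)]

lemma gateLayer_refine {s : ℕ} (hs : s < m) :
    gateLayer σ m N (2 * s + 3) = refineLayer σ N s := by
  unfold gateLayer
  rw [if_neg (by omega), if_neg (by omega), if_pos (by omega), if_neg (by omega)]
  congr 1
  omega

lemma gateLayer_copy (s : ℕ) : gateLayer σ m N (2 * m + 2 + s) = copyLayer := by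
  unfold gateLayer
  rw [if_neg (by omega), if_neg (by omega), if_neg (by omega)]

lemma netWidth_state {s : ℕ} (hs : s ≤ m) :
    netWidth 2 (gateLayer σ m N) (2 * s + 2) = 4 := by
  cases s with
  | zero => simp [netWidth, gateLayer, foldLayer]
  | succ s => exact congrArg ReLULayer.width (gateLayer_refine (σ := σ) (N := N) hs)

lemma netWidth_hinge {s : ℕ} (hs : s < m) :
    netWidth 2 (gateLayer σ m N) (2 * s + 3) = 2 * N + 2 :=
  congrArg ReLULayer.width (gateLayer_hinge (σ := σ) (N := N) hs)

lemma netWidth_copy (s : ℕ) :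
    netWidth 2 (gateLayer σ m N) (2 * m + 2 + (s + 1)) = 8 :=
  congrArg ReLULayer.width (gateLayer_copy (σ := σ) (N := N) s)

/-- Case distinction on the position of a layer in the product gate with `m` refinements. -/
lemma layer_cases (m k : ℕ) :
    k = 0 ∨ k = 1 ∨ (∃ s < m, k = 2 * s + 2) ∨ (∃ s < m, k = 2 * s + 3) ∨
      k = 2 * m + 2 ∨ ∃ s, k = 2 * m + 2 + (s + 1) := by
  by_cases h : k < 2 * m + 2
  · obtain h0 | h0 | h0 | h0 : k = 0 ∨ k = 1 ∨ (2 ≤ k ∧ k % 2 = 0) ∨ (2 ≤ k ∧ k % 2 = 1) := by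
      omega
    · exact .inl h0
    · exact .inr (.inl h0)
    · exact .inr (.inr (.inl ⟨(k - 2) / 2, by omega, by omega⟩))
    · exact .inr (.inr (.inr (.inl ⟨(k - 2) / 2, by omega, by omega⟩)))
  · obtain h0 | h0 : k = 2 * m + 2 ∨ 2 * m + 2 < k := by omega
    · exact .inr (.inr (.inr (.inr (.inl h0))))
    · exact .inr (.inr (.inr (.inr (.inr ⟨k - (2 * m + 2) - 1, by omega⟩))))

lemma productGate_numParams_le (σ : ℝ) (m : ℕ) (hN : 0 < N) :
    (productGate σ m N).numParams ≤ (2 * m + 9) * (92 * N) := by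
  have hw : netWidth 2 (gateLayer σ m N) (2 * m + 8) = 8 := netWidth_copy 5
  refine (numParams_le (C := 92 * N) fun k _ => ?_).trans ?_
  · obtain rfl | rfl | ⟨s, hs, rfl⟩ | ⟨s, hs, rfl⟩ | rfl | ⟨s, rfl⟩ := layer_cases m k
    · simp [netWidth, gateLayer, signLayer]; omega
    · simp [netWidth, gateLayer, signLayer, foldLayer]; omega
    · rw [netWidth_state hs.le, netWidth_hinge hs]; omega
    · rw [netWidth_hinge hs, show 2 * s + 3 + 1 = 2 * (s + 1) + 2 by ring, netWidth_state hs]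
      omega
    · rw [netWidth_state le_rfl, netWidth_copy 0]; omega
    · rw [netWidth_copy, add_assoc, netWidth_copy (s + 1)]; omega
  · rw [hw]
    nlinarith

lemma abs_ite_one_zero_le (p : Prop) [Decidable p] : |if p then (1 : ℝ) else 0| ≤ 1 := by
  split_ifs <;> simp

lemma abs_bumpCoeff_le (hN : 2 ≤ N) (j : ℕ) : |bumpCoeff N j| ≤ 1 := by
  have h : (2 : ℝ) ≤ N := by exact_mod_cast hN
  have h2 : (2 : ℝ) / N ≤ 1 := (div_le_one (by linarith)).2 h
  have h3 : (0 : ℝ) ≤ 2 / N := by positivity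
  have h4 : (1 : ℝ) / N = 2 / N / 2 := by ring
  unfold bumpCoeff kink
  rw [abs_le]
  split_ifs
  · rw [h4]; constructor <;> linarith
  · constructor <;> linarith

lemma productGate_paramBound (m : ℕ) (hN : 2 ≤ N) {R : ℝ} (hR : 1 ≤ R)
    (hσ : |σ| * (2 * N) ≤ R) : (productGate σ m N).paramBound R := by
  have hN' : (2 : ℝ) ≤ N := by exact_mod_cast hN
  have hR0 : (0 : ℝ) ≤ R := by linarith
  have hcopy : ∀ i j, |copyLayer.W i j| ≤ R := fun i j => (abs_ite_one_zero_le _).trans hR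
  refine paramBound_of_forall (fun k _ i hi j hj => ?_) (fun k _ i hi => ?_)
    (fun i => by simpa using hR)
  · obtain rfl | rfl | ⟨s, hs, rfl⟩ | ⟨s, hs, rfl⟩ | rfl | ⟨s, rfl⟩ := layer_cases m k
    · refine le_trans ?_ hR
      simp only [gateLayer, signLayer, if_true, abs_mul]
      split_ifs <;> norm_num [abs_of_pos, abs_of_neg]
    · exact (abs_ite_one_zero_le _).trans hR
    · rw [gateLayer_hinge hs]
      exact (abs_ite_one_zero_le _).trans hR
    · rw [gateLayer_refine hs]
      simp only [refineLayer]
      split_ifs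
      · simpa using hR
      · simpa using hR0
      · refine le_trans ?_ hR
        rw [abs_neg, abs_mul]
        refine mul_le_one₀ ?_ (abs_nonneg _) (abs_bumpCoeff_le hN _)
        rw [abs_of_nonneg (by positivity)]
        exact inv_le_one_of_one_le₀ (one_le_pow₀ (by linarith))
      · refine le_trans ?_ hσ
        rw [abs_mul, abs_mul, abs_mul, abs_pow, abs_neg, abs_one, one_pow, mul_one, Nat.abs_cast]
        gcongr
        unfold kink
        split_ifs <;> norm_num
      · simpa using hR0
    · exact gateLayer_copy (σ := σ) (m := m) (N := N) 0 ▸ hcopy i j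
    · rw [gateLayer_copy]
      exact hcopy i j
  · obtain rfl | rfl | ⟨s, hs, rfl⟩ | ⟨s, hs, rfl⟩ | rfl | ⟨s, rfl⟩ := layer_cases m k
    · simpa [gateLayer, signLayer] using hR0
    · simpa [gateLayer, foldLayer] using hR0
    · rw [netWidth_hinge hs] at hi
      rw [gateLayer_hinge hs]
      simp only [hingeLayer]
      split_ifs
      · simpa using hR0
      · refine le_trans ?_ hR
        rw [abs_neg, abs_of_nonneg (by positivity), div_le_one (by linarith)]
        exact_mod_cast (by omega : i / 2 - 1 ≤ N)
    · rw [gateLayer_refine hs]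
      simpa [refineLayer] using hR0
    · rw [show gateLayer σ m N (2 * m + 2) = copyLayer from gateLayer_copy 0]
      simpa [copyLayer] using hR0
    · rw [gateLayer_copy]
      simpa [copyLayer] using hR0

lemma sum_range_two_mul_add_two (f : ℕ → ℝ) (N : ℕ) :
    ∑ j ∈ Finset.range (2 * N + 2), f j =
      f 0 + f 1 + ∑ j ∈ Finset.range N, (f (2 * j + 2) + f (2 * j + 3)) := by
  induction N with
  | zero => simp [Finset.sum_range_succ]
  | succ N ih =>
    rw [show 2 * (N + 1) + 2 = 2 * N + 2 + 1 + 1 by ring, Finset.sum_range_succ,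
      Finset.sum_range_succ, ih, Finset.sum_range_succ _ N]
    ring

/-- The state of the product gate after `s` refinements: the approximate squares of the two
inputs `v 0` and `v 1`, followed by their images under the iterated triangle wave. -/
def gateState (σ : ℝ) (N s : ℕ) (v : ℕ → ℝ) (i : ℕ) : ℝ :=
  if i < 2 then sqApprox σ N s (v i) else (tooth σ N)^[s] (v (i % 2))

/-- The state of the product gate after the hinge layer. -/
def hingeState (σ : ℝ) (N s : ℕ) (v : ℕ → ℝ) (i : ℕ) : ℝ :=
  if i < 2 then sqApprox σ N s (v i)
  else relu ((tooth σ N)^[s] (v (i % 2)) - ((i / 2 - 1 : ℕ) : ℝ) / N)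

lemma hingeLayer_apply {s : ℕ} {v : ℕ → ℝ} (hG : ∀ i, 0 ≤ sqApprox σ N s (v i)) (i : ℕ) :
    relu ((∑ j ∈ Finset.range 4, (hingeLayer N).W i j * gateState σ N s v j) +
      (hingeLayer N).b i) = hingeState σ N s v i := by
  have hlt : (if i < 2 then i else 2 + i % 2) < 4 := by split_ifs <;> omega
  simp only [hingeLayer, ite_mul, one_mul, zero_mul, Finset.sum_ite_eq', Finset.mem_range, hlt,
    if_true]
  unfold hingeState gateState
  by_cases h : i < 2
  · simp [h, relu_of_nonneg (hG i)]
  · have h' : ¬ 2 + i % 2 < 2 := by omega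
    rw [if_neg h, if_neg h, if_neg h, if_neg h', Nat.add_mod_left, Nat.mod_mod,
      sub_eq_add_neg]

lemma refineLayer_apply {s : ℕ} {v : ℕ → ℝ} (hG : ∀ i, 0 ≤ sqApprox σ N (s + 1) (v i))
    (ht : ∀ i, 0 ≤ (tooth σ N)^[s + 1] (v i)) {i : ℕ} (hi : i < 4) :
    relu ((∑ j ∈ Finset.range (2 * N + 2), (refineLayer σ N s).W i j * hingeState σ N s v j) +
      (refineLayer σ N s).b i) = gateState σ N (s + 1) v i := by
  have e1 : ∀ j, (2 * j + 2) / 2 - 1 = j := fun j => by omega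
  have e2 : ∀ j, (2 * j + 3) / 2 - 1 = j := fun j => by omega
  have e3 : ∀ j, (2 * j + 2) % 2 = 0 := fun j => by omega
  have e4 : ∀ j, (2 * j + 3) % 2 = 1 := fun j => by omega
  have e5 : ∀ j, ¬ 2 * j + 2 < 2 := fun j => by omega
  have e6 : ∀ j, ¬ 2 * j + 3 < 2 := fun j => by omega
  have hs : ∀ x, sqApprox σ N s x + -∑ j ∈ Finset.range N,
      ((N : ℝ) ^ (2 * s))⁻¹ * bumpCoeff N j * relu ((tooth σ N)^[s] x - j / N) =
        sqApprox σ N (s + 1) x := fun x => by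
    simp only [sqApprox, bump, Finset.mul_sum, mul_assoc, ← sub_eq_add_neg]
  have hts : ∀ x, ∑ j ∈ Finset.range N,
      σ * (kink j * (-1) ^ j * N) * relu ((tooth σ N)^[s] x - j / N) =
        (tooth σ N)^[s + 1] x := fun x => by
    rw [Function.iterate_succ_apply', tooth]
  rw [sum_range_two_mul_add_two]
  unfold gateState
  interval_cases i
  · simpa [refineLayer, hingeState, e1, e2, e3, e4, e5, e6, hs] using relu_of_nonneg (hG 0)
  · simpa [refineLayer, hingeState, e1, e2, e3, e4, e5, e6, hs] using relu_of_nonneg (hG 1)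
  · simpa [refineLayer, hingeState, e1, e2, e3, e4, e5, e6, hts] using relu_of_nonneg (ht 0)
  · simpa [refineLayer, hingeState, e1, e2, e3, e4, e5, e6, hts] using relu_of_nonneg (ht 1)

lemma productGate_hidden_succ {x : Fin 2 → ℝ} {k : ℕ} {F : ℕ → ℝ}
    (hF : ∀ i, (productGate σ m N).hidden x k i = F i)
    (i : Fin ((productGate σ m N).width (k + 1))) :
    (productGate σ m N).hidden x (k + 1) i =
      relu ((∑ j ∈ Finset.range (netWidth 2 (gateLayer σ m N) k),
        (gateLayer σ m N k).W i j * F j) + (gateLayer σ m N k).b i) :=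
  hidden_succ hF i

lemma foldLayer_apply (u u' : ℝ) {v : ℕ → ℝ} (hv0 : v 0 = |(u + u') / 4|)
    (hv1 : v 1 = |(u - u') / 4|) {i : ℕ} (hi : i < 4) :
    relu ((∑ j ∈ Finset.range 4, foldLayer.W i j * relu ((∑ k ∈ Finset.range 2,
      signLayer.W j k * (if k = 0 then u else u')) + 0)) + 0) = gateState σ N 0 v i := by
  have h0 : relu (relu (4⁻¹ * u + 4⁻¹ * u') + relu (-1 / 4 * u + -1 / 4 * u')) = v 0 := by
    rw [show 4⁻¹ * u + 4⁻¹ * u' = (u + u') / 4 by ring,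
      show -1 / 4 * u + -1 / 4 * u' = -((u + u') / 4) by ring, relu_add_relu_neg, ← hv0]
    exact relu_of_nonneg (hv0 ▸ abs_nonneg _)
  have h1 : relu (relu (4⁻¹ * u + -(4⁻¹ * u')) + relu (-1 / 4 * u + -(-1 / 4 * u'))) = v 1 := by
    rw [show 4⁻¹ * u + -(4⁻¹ * u') = (u - u') / 4 by ring,
      show -1 / 4 * u + -(-1 / 4 * u') = -((u - u') / 4) by ring, relu_add_relu_neg, ← hv1]
    exact relu_of_nonneg (hv1 ▸ abs_nonneg _)
  interval_cases i
  · simpa [foldLayer, signLayer, gateState, sqApprox, Finset.sum_range_succ] using h0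
  · simpa [foldLayer, signLayer, gateState, sqApprox, Finset.sum_range_succ] using h1
  · simpa [foldLayer, signLayer, gateState, sqApprox, Finset.sum_range_succ] using h0
  · simpa [foldLayer, signLayer, gateState, sqApprox, Finset.sum_range_succ] using h1

lemma productGate_eval (u u' : ℝ) (v : ℕ → ℝ) (hv0 : v 0 = |(u + u') / 4|)
    (hv1 : v 1 = |(u - u') / 4|) (hv : ∀ i, v (i % 2) = v i)
    (hG : ∀ s i, 0 ≤ sqApprox σ N s (v i)) (ht : ∀ s i, 0 ≤ (tooth σ N)^[s] (v i)) :
    (productGate σ m N).eval ![u, u'] =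
      4 * (sqApprox σ N m (v 0) - sqApprox σ N m (v 1)) := by
  have hinput : ∀ i, (productGate σ m N).hidden ![u, u'] 0 i =
      (fun j : ℕ => if j = 0 then u else u') i := by
    intro i
    change Fin 2 at i
    fin_cases i <;> rfl
  have hsign := productGate_hidden_succ (F := fun j => if j = 0 then u else u') hinput
  have hfold := productGate_hidden_succ (σ := σ) (m := m) (N := N) (k := 1)
    (x := ![u, u']) (F := fun i => relu ((∑ j ∈ Finset.range 2,
    signLayer.W i j * (if j = 0 then u else u')) + 0)) hsign
  have hstate : ∀ s ≤ m, ∀ i, (productGate σ m N).hidden ![u, u'] (2 * s + 2) i =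
      gateState σ N s v i := by
    intro s
    induction s with
    | zero =>
      intro _ i
      refine (hfold i).trans ?_
      exact foldLayer_apply u u' hv0 hv1 i.2
    | succ s ih =>
      intro hs i
      have hs' : s < m := hs
      have h1 := productGate_hidden_succ (ih hs'.le)
      rw [netWidth_state hs'.le, gateLayer_hinge hs'] at h1
      have h2 := productGate_hidden_succ (σ := σ) (m := m) (N := N) (k := 2 * s + 3)
        (x := ![u, u']) (F := hingeState σ N s v) fun i => (h1 i).trans (hingeLayer_apply (hG s) i)
      rw [netWidth_hinge hs', gateLayer_refine hs'] at h2
      refine (h2 i).trans (refineLayer_apply (hG _) (ht _) ?_)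
      exact lt_of_lt_of_eq i.2 (netWidth_state hs)
  have hcopy : ∀ s i, (productGate σ m N).hidden ![u, u'] (2 * m + 2 + (s + 1)) i =
      (fun j : ℕ => sqApprox σ N m (v j)) i := by
    intro s
    have hmod : ∀ i, i % 2 < 2 := fun i => Nat.mod_lt _ two_pos
    induction s with
    | zero =>
      intro i
      refine (productGate_hidden_succ (hstate m le_rfl) i).trans ?_
      have hlt : (i : ℕ) % 2 < 4 := (hmod i).trans (by norm_num)
      rw [netWidth_state le_rfl, show gateLayer σ m N (2 * m + 2) = copyLayer from gateLayer_copy 0]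
      simp only [copyLayer, ite_mul, one_mul, zero_mul, Finset.sum_ite_eq', Finset.mem_range, hlt,
        if_true, gateState, hmod, hv, add_zero, relu_of_nonneg (hG m i)]
    | succ s ih =>
      intro i
      refine (hidden_succ (F := fun j => sqApprox σ N m (v j)) ih i).trans ?_
      have hlt : (i : ℕ) % 2 < 8 := (hmod i).trans (by norm_num)
      rw [netWidth_copy, gateLayer_copy]
      simp [copyLayer, hlt, hv, relu_of_nonneg (hG m i)]
  have hw : netWidth 2 (gateLayer σ m N) (2 * m + 8) = 8 := netWidth_copy 5
  have := eval_eq (F := fun j => sqApprox σ N m (v j)) (hcopy 5)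
  rw [hw] at this
  refine this.trans ?_
  have hv' : ∀ i, v (i + 2) = v i := fun i => by rw [← hv, Nat.add_mod_right, hv]
  simp only [Finset.sum_range_succ, Finset.sum_range_zero, hv' 0, hv' 1, hv' 2, hv' 3, hv' 4,
    hv' 5]
  ring

/-- The error of the product gate in terms of the error of the approximate square. -/
lemma productGate_error {ε : ℝ}
    (hnonneg : ∀ s, ∀ x ∈ Set.Icc (0 : ℝ) 1, 0 ≤ sqApprox σ N s x ∧ 0 ≤ (tooth σ N)^[s] x)
    (herr : ∀ x ∈ Set.Icc (0 : ℝ) 1, sqApprox σ N m x - x ^ 2 ∈ Set.Icc 0 (ε / 4)) (u u' : ℝ)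
    (hu : u ∈ Set.Icc (-2 : ℝ) 2) (hu' : u' ∈ Set.Icc (-2 : ℝ) 2) :
    |u * u' - (productGate σ m N).eval ![u, u']| ≤ ε := by
  have hx : |(u + u') / 4| ∈ Set.Icc (0 : ℝ) 1 :=
    ⟨abs_nonneg _, abs_le.2 ⟨by linarith [hu.1, hu'.1], by linarith [hu.2, hu'.2]⟩⟩
  have hy : |(u - u') / 4| ∈ Set.Icc (0 : ℝ) 1 :=
    ⟨abs_nonneg _, abs_le.2 ⟨by linarith [hu.1, hu'.2], by linarith [hu.2, hu'.1]⟩⟩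
  let v : ℕ → ℝ := fun i => if i % 2 = 0 then |(u + u') / 4| else |(u - u') / 4|
  have hv : ∀ i, v i ∈ Set.Icc (0 : ℝ) 1 := fun i => by
    simp only [v]
    split_ifs
    exacts [hx, hy]
  rw [productGate_eval u u' v rfl rfl (fun i => by simp [v]) (fun s i => (hnonneg s _ (hv i)).1)
    (fun s i => (hnonneg s _ (hv i)).2)]
  change |u * u' - 4 * (sqApprox σ N m |(u + u') / 4| - sqApprox σ N m |(u - u') / 4|)| ≤ ε
  obtain ⟨h1, h2⟩ := herr _ hx
  obtain ⟨h3, h4⟩ := herr _ hy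
  rw [sq_abs] at h1 h2 h3 h4
  rw [abs_le]
  constructor <;> nlinarith

end Layers

lemma scaled_mem {c t ε : ℝ} (hc : 0 ≤ c) (hcε : c ≤ ε) (ht : t ∈ Set.Icc (0 : ℝ) (1 / 4)) :
    c * t ∈ Set.Icc 0 (ε / 4) :=
  ⟨mul_nonneg hc ht.1, by nlinarith [ht.1, ht.2]⟩

/-- two-factor product gate with accuracy-independent depth,
Lemma 6 of the paper.  Let `θ > 0` and `L̃ ∈ ℕ` with `L̃ > 1/(2θ)`.  Then there are
constants `c, γ > 0` depending only on `L̃` and `θ` such that for every `ε ∈ (0,1)`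
there exists a deep ReLU net `×̃₂ : ℝ² → ℝ` with `2L̃ + 8` hidden layers and at most
`c ε^{-θ}` nonzero parameters, each bounded in absolute value by `ε^{-γ}`, such that
`|uu′ − ×̃₂(u,u′)| ≤ ε` for all `u, u′ ∈ [-2,2]`. -/
theorem product_gate_two (θ : ℝ) (hθ : 0 < θ) (Lt : ℕ) (hLt : 1 / (2 * θ) < (Lt : ℝ)) :
    ∃ c γ : ℝ, 0 < c ∧ 0 < γ ∧
      ∀ ε : ℝ, ε ∈ Set.Ioo (0 : ℝ) 1 →
        ∃ net : ReLUNet 2,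
          net.L = 2 * Lt + 8 ∧
          (net.numParams : ℝ) ≤ c * ε ^ (-θ) ∧
          net.paramBound (ε ^ (-γ)) ∧
          ∀ u u' : ℝ, u ∈ Set.Icc (-2 : ℝ) 2 → u' ∈ Set.Icc (-2 : ℝ) 2 →
            |u * u' - net.eval ![u, u']| ≤ ε := by
  have hm : (0 : ℝ) < Lt := lt_trans (by positivity) hLt
  have hm' : 0 < Lt := by exact_mod_cast hm
  have hexp : (1 : ℝ) / (2 * Lt) ≤ θ := by
    rw [div_lt_iff₀ (by positivity)] at hLt
    rw [div_le_iff₀ (by positivity)]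
    linarith
  refine ⟨(2 * Lt + 9) * 184, 2 + θ, by positivity, by positivity, fun ε ⟨hε0, hε1⟩ => ?_⟩
  set p : ℝ := ε ^ (-(1 / (2 * (Lt : ℝ)))) with hp
  have hp1 : 1 < p := Real.one_lt_rpow_of_pos_of_lt_one_of_neg hε0 hε1 (by simpa using hm')
  have hpθ : p ≤ ε ^ (-θ) := Real.rpow_le_rpow_of_exponent_ge hε0 hε1.le (neg_le_neg hexp)
  set N : ℕ := ⌈p⌉₊ with hNdef
  have hpN : p ≤ N := Nat.le_ceil p
  have hN2 : 2 ≤ N := by exact_mod_cast Nat.lt_ceil.2 (by simpa using hp1)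
  have hN0 : 0 < N := by omega
  have hN : (N : ℝ) ≤ 2 * ε ^ (-θ) := by
    have := Nat.ceil_lt_add_one (zero_le_one.trans hp1.le)
    linarith
  have hNε : ((N : ℝ) ^ (2 * Lt))⁻¹ ≤ ε := by
    have h1 : p ^ (2 * Lt) = ε⁻¹ := by
      rw [hp, ← Real.rpow_natCast, ← Real.rpow_mul hε0.le, ← Real.rpow_neg_one]
      congr 1
      push_cast
      field_simp
    have h2 : p ^ (2 * Lt) ≤ (N : ℝ) ^ (2 * Lt) :=
      pow_le_pow_left₀ (zero_le_one.trans hp1.le) hpN _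
    rw [h1] at h2
    exact inv_le_of_inv_le₀ hε0 h2
  have hparams : ∀ σ, ((productGate σ Lt N).numParams : ℝ) ≤ (2 * Lt + 9) * 184 * ε ^ (-θ) := by
    intro σ
    have h1 : ((productGate σ Lt N).numParams : ℝ) ≤ (2 * Lt + 9) * (92 * N) := by
      exact_mod_cast productGate_numParams_le σ Lt hN0
    refine h1.trans ?_
    rw [mul_assoc]
    exact mul_le_mul_of_nonneg_left (by linarith) (by positivity)
  have hR : 1 ≤ ε ^ (-(2 + θ)) :=
    Real.one_le_rpow_of_pos_of_le_one_of_nonpos hε0 hε1.le (by linarith)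
  rcases le_or_gt ε (1 / 2) with hε | hε
  · refine ⟨productGate 1 Lt N, rfl, hparams 1, productGate_paramBound Lt hN2 hR ?_, ?_⟩
    · have h1 : ε ^ (-(2 + θ)) = (ε ^ 2)⁻¹ * ε ^ (-θ) := by
        rw [neg_add, Real.rpow_add hε0, Real.rpow_neg hε0.le 2, Real.rpow_two]
      have h2 : 4 ≤ (ε ^ 2)⁻¹ := by
        rw [le_inv_comm₀ (by norm_num) (by positivity)]
        nlinarith
      have h3 : 0 < ε ^ (-θ) := Real.rpow_pos_of_pos hε0 _
      rw [h1, abs_one, one_mul]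
      nlinarith
    · refine productGate_error (fun s x hx => ?_) (fun x hx => ?_)
      · obtain ⟨h1, h2⟩ := sqApprox_one hN0 hx s
        refine ⟨?_, h1.1⟩
        have h3 : 0 ≤ sqApprox 1 N s x - x ^ 2 := by
          rw [h2]
          exact mul_nonneg (by positivity) (sub_sq_mem h1).1
        nlinarith [sq_nonneg x]
      · obtain ⟨h1, h2⟩ := sqApprox_one hN0 hx Lt
        rw [h2]
        exact scaled_mem (by positivity) hNε (sub_sq_mem h1)
  · refine ⟨productGate 0 Lt N, rfl, hparams 0, productGate_paramBound Lt hN2 hR ?_, ?_⟩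
    · rw [abs_zero, zero_mul]
      exact zero_le_one.trans hR
    · refine productGate_error (fun s x hx => ?_) (fun x hx => ?_)
      · cases s with
        | zero => exact ⟨hx.1, hx.1⟩
        | succ s =>
          obtain ⟨h1, h2⟩ := sqApprox_zero hN0 hx s
          refine ⟨?_, h1.ge⟩
          have h3 : 0 ≤ sqApprox 0 N (s + 1) x - x ^ 2 := by
            rw [h2]
            exact mul_nonneg (by positivity) (sub_sq_mem (tooth_bump hN0 hx).1).1
          nlinarith [sq_nonneg x]
      · obtain ⟨k, rfl⟩ : ∃ k, Lt = k + 1 := ⟨Lt - 1, by omega⟩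
        rw [(sqApprox_zero hN0 hx k).2]
        refine scaled_mem (by positivity) ?_ (sub_sq_mem (tooth_bump hN0 hx).1)
        have h1 : (2 : ℝ) ≤ N := by exact_mod_cast hN2
        have h2 : ((N : ℝ) ^ 2)⁻¹ ≤ 1 / 4 := by
          rw [inv_le_comm₀ (by positivity) (by norm_num)]
          nlinarith
        linarith

end
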